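/- arXiv:math/0506610 — 2 statements merged into one kernel-verified Lean document; each statement's English description precedes it below -/
import Mathlib

section
/- Let η = exp(2πi/12) ∈ ℂ (a primitive 12th root of unity) and let m₁, m₂, m₄, m₁₀ be nonnegative integers satisfying, as complex numbers, 0 = −(1 + η⁻³) + Σ_{i ∈ {1,2,4,10}} mᵢ / ((1 − η⁻ⁱ)(1 − η^{3+i})), together with m₁ + m₂ + m₄ + m₁₀ ≤ 6. Then (m₁, m₂, m₄, m₁₀) is one of (3, 0, 0, 1), (1, 0, 1, 0), (2, 1, 2, 1), (0, 1, 3, 0); in particular m₁ + m₂ + m₄ + m₁₀ ∈ {2, 4, 6}. -/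
open Complex in
/-- The `12`-th root of unity `exp (2πi/12)` in algebraic form. -/
theorem exp_two_pi_mul_I_div_twelve :
    exp (2 * Real.pi * I / 12) = ((√3 : ℝ) + I) / 2 := by
  have h : 2 * Real.pi * I / 12 = ((Real.pi / 6 : ℝ) : ℂ) * I := by
    push_cast
    ring
  rw [h, exp_mul_I, ← ofReal_cos, ← ofReal_sin, Real.cos_pi_div_six, Real.sin_pi_div_six]
  push_cast
  ring

/-- `1` and `√3` are linearly independent over `ℤ`. -/
theorem eq_zero_of_add_mul_sqrt_three_eq_zero {a b : ℤ} (h : (a : ℝ) + b * √3 = 0) :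
    a = 0 ∧ b = 0 := by
  have hb : b = 0 := by
    by_contra hb
    have hirr : Irrational (√3 : ℝ) := by
      simpa using Nat.prime_three.irrational_sqrt
    exact ((hirr.intCast_mul hb).intCast_add a).ne_zero h
  subst hb
  exact ⟨by simpa using h, rfl⟩

/-- Division by an element with known inverse. -/
theorem div_eq_mul_of_mul_eq_one {K : Type*} [Field K] {d c : K} (h : d * c = 1) (x : K) :
    x / d = x * c := by
  rw [div_eq_mul_inv, inv_eq_of_mul_eq_one_right h]

/-- Negative powers of a `12`-th root of unity as nonnegative powers. -/
theorem zpow_neg_eq_pow_of_pow_twelve {K : Type*} [Field K] {η : K} (h : η ^ 12 = 1)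
    {m n : ℕ} (hmn : m + n = 12) : η ^ (-(m : ℤ)) = η ^ n := by
  rw [zpow_neg, zpow_natCast]
  exact inv_eq_of_mul_eq_one_right (by rw [← pow_add, hmn, h])

/-- Holomorphic Lefschetz constraint for an order-12 automorphism `g` of a K3
surface with `g*ω_X = η³ ω_X`, where `η = exp(2πi/12)`: the point counts
`(m₁, m₂, m₄, m₁₀)` are among `(3,0,0,1), (1,0,1,0), (2,1,2,1), (0,1,3,0)`;
in particular the total number of fixed points is `2`, `4` or `6`. -/
theorem stmt_4 (η : ℂ) (hη : η = Complex.exp (2 * Real.pi * Complex.I / 12))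
    (m₁ m₂ m₄ m₁₀ : ℕ)
    (h : (0 : ℂ) = -(1 + η ^ (-3 : ℤ))
        + (m₁ : ℂ) / ((1 - η ^ (-1 : ℤ)) * (1 - η ^ (4 : ℕ)))
        + (m₂ : ℂ) / ((1 - η ^ (-2 : ℤ)) * (1 - η ^ (5 : ℕ)))
        + (m₄ : ℂ) / ((1 - η ^ (-4 : ℤ)) * (1 - η ^ (7 : ℕ)))
        + (m₁₀ : ℂ) / ((1 - η ^ (-10 : ℤ)) * (1 - η ^ (13 : ℕ))))
    (hsum : m₁ + m₂ + m₄ + m₁₀ ≤ 6) :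
    ((m₁, m₂, m₄, m₁₀) = (3, 0, 0, 1) ∨ (m₁, m₂, m₄, m₁₀) = (1, 0, 1, 0) ∨
      (m₁, m₂, m₄, m₁₀) = (2, 1, 2, 1) ∨ (m₁, m₂, m₄, m₁₀) = (0, 1, 3, 0)) ∧
    (m₁ + m₂ + m₄ + m₁₀ = 2 ∨ m₁ + m₂ + m₄ + m₁₀ = 4 ∨ m₁ + m₂ + m₄ + m₁₀ = 6) := by
  rw [exp_two_pi_mul_I_div_twelve] at hη
  have hs : ((√3 : ℝ) : ℂ) ^ 2 = 3 := by
    rw [← Complex.ofReal_pow, Real.sq_sqrt (by norm_num)]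
    norm_num
  have hI := Complex.I_sq
  have h3 : η ^ 3 = Complex.I := by grind
  have hsη : ((√3 : ℝ) : ℂ) = 2 * η - η ^ 3 := by grind
  have h4 : η ^ 4 = η ^ 2 - 1 := by grind
  have h12 : η ^ 12 = 1 := by grind
  have e1 : η ^ (-1 : ℤ) = η ^ 11 := zpow_neg_eq_pow_of_pow_twelve h12 (m := 1) rfl
  have e2 : η ^ (-2 : ℤ) = η ^ 10 := zpow_neg_eq_pow_of_pow_twelve h12 (m := 2) rfl
  have e3 : η ^ (-3 : ℤ) = η ^ 9 := zpow_neg_eq_pow_of_pow_twelve h12 (m := 3) rfl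
  have e4 : η ^ (-4 : ℤ) = η ^ 8 := zpow_neg_eq_pow_of_pow_twelve h12 (m := 4) rfl
  have e10 : η ^ (-10 : ℤ) = η ^ 2 := zpow_neg_eq_pow_of_pow_twelve h12 (m := 10) rfl
  have d1 : (1 - η ^ 11) * (1 - η ^ 4) * ((1 - η ^ 3) * ((3 + (2 * η - η ^ 3)) / 6)) = 1 := by
    clear h; grind
  have d2 : (1 - η ^ 10) * (1 - η ^ 5) * ((1 - η ^ 3) * ((2 * η - η ^ 3 - 1) / 2)) = 1 := by
    clear h; grind
  have d4 : (1 - η ^ 8) * (1 - η ^ 7) * ((1 - η ^ 3) * ((3 - (2 * η - η ^ 3)) / 6)) = 1 := by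
    clear h; grind
  have d10 : (1 - η ^ 2) * (1 - η ^ 13) * ((1 - η ^ 3) * (-(1 + (2 * η - η ^ 3)) / 2)) = 1 := by
    clear h; grind
  have h9 : η ^ 9 = -η ^ 3 := by clear h; grind
  rw [e1, e2, e3, e4, e10, h9, div_eq_mul_of_mul_eq_one d1, div_eq_mul_of_mul_eq_one d2,
    div_eq_mul_of_mul_eq_one d4, div_eq_mul_of_mul_eq_one d10, ← hsη, h3] at h
  have hI1 : 1 - Complex.I ≠ 0 := fun hz => by simpa using congrArg Complex.im hz
  have hlin : (((-6 + 3 * m₁ - 3 * m₂ + 3 * m₄ - 3 * m₁₀ : ℤ) : ℝ)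
      + ((m₁ + 3 * m₂ - m₄ - 3 * m₁₀ : ℤ) : ℝ) * √3) = 0 := by
    apply Complex.ofReal_injective
    apply mul_left_cancel₀ hI1
    push_cast
    linear_combination -6 * h
  obtain ⟨ha, hb⟩ := eq_zero_of_add_mul_sqrt_three_eq_zero hlin
  simp only [Prod.mk.injEq]
  omega
end

section
/- Let G be a finite group and N a normal subgroup of index 2 in G such that N is isomorphic (as a group) to the alternating group A₅ on 5 letters. Then G is isomorphic either to the direct product A₅ × ℤ/2ℤ or to the symmetric group S₅ on 5 letters (Equiv.Perm (Fin 5)). -/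
open Equiv

/-- The Klein four subgroup of `A₅` acting on the first four letters. -/
def kleinFourA5 : Subgroup (alternatingGroup (Fin 5)) where
  carrier := {x | x.1 = 1 ∨ x.1 = swap 0 1 * swap 2 3 ∨ x.1 = swap 0 2 * swap 1 3 ∨
    x.1 = swap 0 3 * swap 1 2}
  one_mem' := Or.inl rfl
  mul_mem' := by
    rintro ⟨x, _⟩ ⟨y, _⟩ hx hy
    simp only [Set.mem_ofPred_eq, Subgroup.coe_mul] at *
    rcases hx with rfl | rfl | rfl | rfl <;> rcases hy with rfl | rfl | rfl | rfl <;> decide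
  inv_mem' := by
    rintro ⟨x, _⟩ hx
    simp only [Set.mem_ofPred_eq, Subgroup.coe_inv] at *
    rcases hx with rfl | rfl | rfl | rfl <;> decide

theorem mem_kleinFourA5 {x : alternatingGroup (Fin 5)} :
    x ∈ kleinFourA5 ↔ x.1 = 1 ∨ x.1 = swap 0 1 * swap 2 3 ∨ x.1 = swap 0 2 * swap 1 3 ∨
      x.1 = swap 0 3 * swap 1 2 := Iff.rfl

theorem card_kleinFourA5 : Nat.card kleinFourA5 = 4 := by
  have h : (kleinFourA5.map (alternatingGroup (Fin 5)).subtype : Set (Perm (Fin 5))) =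
      (({1, swap 0 1 * swap 2 3, swap 0 2 * swap 1 3, swap 0 3 * swap 1 2} :
        Finset (Perm (Fin 5))) : Set (Perm (Fin 5))) := by
    ext x
    simp only [Subgroup.coe_map, Subgroup.coe_subtype, Set.mem_image, SetLike.mem_coe,
      mem_kleinFourA5, Finset.mem_insert, Finset.mem_singleton]
    refine ⟨?_, fun hx => ⟨⟨x, ?_⟩, hx, rfl⟩⟩
    · rintro ⟨y, hy, rfl⟩
      exact hy
    · rw [Equiv.Perm.mem_alternatingGroup]
      rcases hx with rfl | rfl | rfl | rfl <;> decide
  rw [← Subgroup.card_map_of_injective (K := kleinFourA5)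
    (alternatingGroup (Fin 5)).subtype_injective, ← SetLike.coe_sort_coe, h,
    Nat.card_coe_set_eq, Set.ncard_coe_finset]
  decide

theorem natCard_alternatingGroup_fin_five : Nat.card (alternatingGroup (Fin 5)) = 60 := by
  rw [nat_card_alternatingGroup]
  simp [Nat.factorial]

theorem card_sylow_two_alternatingGroup_five :
    Nat.card (Sylow 2 (alternatingGroup (Fin 5))) ≤ 5 := by
  let P : Sylow 2 (alternatingGroup (Fin 5)) := Sylow.ofCard kleinFourA5 <| by
    rw [card_kleinFourA5, natCard_alternatingGroup_fin_five,
      Nat.factorization_def _ Nat.prime_two, show 60 = 2 ^ 2 * 15 by norm_num,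
      padicValNat_base_pow_mul (by norm_num),
      padicValNat.eq_zero_of_not_dvd (by norm_num)] <;> norm_num
  let t : alternatingGroup (Fin 5) := ⟨swap 0 1 * swap 1 2, by
    rw [Equiv.Perm.mem_alternatingGroup]; decide⟩
  have ht : orderOf t = 3 := orderOf_eq_prime (by decide) (by decide)
  have htn : t ∈ Subgroup.normalizer (kleinFourA5 : Set (alternatingGroup (Fin 5))) := by
    rw [Subgroup.mem_normalizer_iff_map_conj_eq]
    refine Subgroup.eq_of_le_of_card_ge ?_
      (Subgroup.card_map_of_injective (MulAut.conj t).injective).ge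
    rintro _ ⟨⟨x, _⟩, hx, rfl⟩
    simp only [MonoidHom.coe_coe, MulAut.conj_apply, SetLike.mem_coe, mem_kleinFourA5,
      Subgroup.coe_mul, Subgroup.coe_inv, t] at hx ⊢
    rcases hx with rfl | rfl | rfl | rfl <;> decide
  set H := Subgroup.normalizer (kleinFourA5 : Set (alternatingGroup (Fin 5)))
  have h4 : 4 ∣ Nat.card H := card_kleinFourA5 ▸ Subgroup.card_dvd_of_le Subgroup.le_normalizer
  have h3 : 3 ∣ Nat.card H := ht ▸ Subgroup.orderOf_dvd_natCard H htn
  have h12 : 12 ∣ Nat.card H := Nat.Coprime.mul_dvd_of_dvd_of_dvd (by norm_num) h4 h3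
  have hmul := H.card_mul_index
  have hP : Nat.card (Sylow 2 (alternatingGroup (Fin 5))) = H.index := P.card_eq_index_normalizer
  rw [natCard_alternatingGroup_fin_five] at hmul
  rw [hP]
  have := Nat.le_of_dvd Nat.card_pos h12
  nlinarith

/-- The conjugation action of `G` on the Sylow `p`-subgroups of a normal subgroup. -/
def conjSylowHom {G : Type*} [Group G] (p : ℕ) (N : Subgroup G) [N.Normal] :
    G →* Perm (Sylow p N) :=
  (MulAction.toPermHom (MulAut N) (Sylow p N)).comp MulAut.conjNormal

theorem conjSylowHom_apply_of_mem {G : Type*} [Group G] {p : ℕ} {N : Subgroup G} [N.Normal]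
    (n : N) (P : Sylow p N) : conjSylowHom p N n P = n • P := by
  rw [Sylow.smul_def, ← MulAut.conjNormal_val]
  rfl

/-- If a Sylow subgroup of a simple normal subgroup `N` is proper and nontrivial, then `N` acts
faithfully on its Sylow subgroups. -/
theorem disjoint_ker_conjSylowHom {G : Type*} [Group G] {p : ℕ} [Fact p.Prime] {N : Subgroup G}
    [N.Normal] [Finite N] [IsSimpleGroup N] (P : Sylow p N) (hbot : (P : Subgroup N) ≠ ⊥)
    (htop : (P : Subgroup N) ≠ ⊤) : Disjoint N (conjSylowHom p N).ker := by
  have hnormal : ((conjSylowHom p N).ker.subgroupOf N).Normal := inferInstance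
  rcases hnormal.eq_bot_or_eq_top with h | h
  · exact (Subgroup.subgroupOf_eq_bot.mp h).symm
  · have hP : (P : Subgroup N).Normal := by
      rw [← Subgroup.normalizer_eq_top_iff, eq_top_iff]
      intro n _
      have hn : n ∈ (conjSylowHom p N).ker.subgroupOf N := h ▸ Subgroup.mem_top n
      rw [Subgroup.mem_subgroupOf, MonoidHom.mem_ker] at hn
      exact Sylow.smul_eq_iff_mem_normalizer.mp <| by
        rw [← conjSylowHom_apply_of_mem, hn, Perm.one_apply]
    exact (hP.eq_bot_or_eq_top.elim hbot htop).elim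

/-- A subgroup disjoint from a normal subgroup has order at most its index. -/
theorem card_le_index_of_disjoint {G : Type*} [Group G] [Finite G] {N K : Subgroup G} [N.Normal]
    (h : Disjoint N K) : Nat.card K ≤ N.index := by
  refine Nat.card_le_card_of_injective ((QuotientGroup.mk' N).comp K.subtype) ?_
  rw [← MonoidHom.ker_eq_bot_iff, ← MonoidHom.comap_ker, QuotientGroup.ker_mk']
  exact Subgroup.subgroupOf_eq_bot.mpr h

/-- A finite group is the product of disjoint normal subgroups of complementary order. -/
theorem nonempty_mulEquiv_prod_of_disjoint {G : Type*} [Group G] [Finite G] {N K : Subgroup G}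
    [hN : N.Normal] [hK : K.Normal] (h : Disjoint N K)
    (hcard : Nat.card N * Nat.card K = Nat.card G) : Nonempty (N × K ≃* G) := by
  have comm (n : N) (k : K) : Commute (N.subtype n) (K.subtype k) :=
    Subgroup.commute_of_normal_of_disjoint N K hN hK h n k n.2 k.2
  refine ⟨MulEquiv.ofBijective (N.subtype.noncommCoprod K.subtype comm) ?_⟩
  rw [Nat.bijective_iff_injective_and_card, Nat.card_prod]
  exact ⟨(MonoidHom.noncommCoprod_injective _ _ comm).mpr
    ⟨N.subtype_injective, K.subtype_injective, by simpa using h⟩, hcard⟩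

/-- The group-theoretic classification used in Section 3: a finite group `G`
with a normal subgroup `N ≅ A₅` of index 2 is isomorphic to `A₅ × ℤ/2` or to
`S₅`. -/
theorem stmt_10 (G : Type) [Group G] [Finite G] (N : Subgroup G) [N.Normal]
    (hN : Nonempty (N ≃* alternatingGroup (Fin 5))) (hidx : N.index = 2) :
    Nonempty (G ≃* alternatingGroup (Fin 5) × Multiplicative (ZMod 2)) ∨
      Nonempty (G ≃* Equiv.Perm (Fin 5)) := by
  obtain ⟨e⟩ := hN
  have : IsSimpleGroup N := e.isSimpleGroup
  have hcN : Nat.card N = 60 := (Nat.card_congr e.toEquiv).trans natCard_alternatingGroup_fin_five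
  have hcG : Nat.card G = 120 := by rw [← N.card_mul_index, hcN, hidx]
  have hX : Nat.card (Sylow 2 N) ≤ 5 :=
    (Nat.card_le_card_of_surjective _ (Sylow.mapSurjective_surjective (f := e.symm.toMonoidHom)
      e.symm.surjective 2)).trans
      card_sylow_two_alternatingGroup_five
  obtain ⟨P⟩ : Nonempty (Sylow 2 N) := inferInstance
  have hdisj : Disjoint N (conjSylowHom 2 N).ker := by
    refine disjoint_ker_conjSylowHom P (P.ne_bot_of_dvd_card (by rw [hcN]; norm_num)) fun htop => ?_
    obtain ⟨k, hk⟩ := P.2.exists_card_eq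
    have h3 : 3 ∣ 2 ^ k := by
      rw [← hk, htop, Subgroup.card_top, hcN]
      norm_num
    exact absurd (Nat.prime_three.dvd_of_dvd_pow h3) (by norm_num)
  by_cases hker : (conjSylowHom 2 N).ker = ⊥
  · right
    have hinj := (MonoidHom.ker_eq_bot_iff _).mp hker
    have hle := Nat.card_le_card_of_injective _ hinj
    rw [hcG, Nat.card_perm] at hle
    have hX5 : Nat.card (Sylow 2 N) = 5 := by
      generalize Nat.card (Sylow 2 N) = n at hX hle
      interval_cases n <;> simp [Nat.factorial] at hle ⊢
    have hbij := (Nat.bijective_iff_injective_and_card _).mpr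
      ⟨hinj, by rw [hcG, Nat.card_perm, hX5]; rfl⟩
    exact ⟨(MulEquiv.ofBijective _ hbij).trans (Finite.equivFinOfCardEq hX5).permCongrHom⟩
  · left
    have hK : Nat.card (conjSylowHom 2 N).ker = 2 :=
      le_antisymm ((card_le_index_of_disjoint hdisj).trans_eq hidx)
        ((Subgroup.one_lt_card_iff_ne_bot _).mpr hker)
    obtain ⟨f⟩ := nonempty_mulEquiv_prod_of_disjoint hdisj (by rw [hcN, hK, hcG])
    have : Fact (Nat.Prime 2) := ⟨Nat.prime_two⟩
    exact ⟨f.symm.trans (e.prodCongr (mulEquivOfPrimeCardEq hK (by simp)))⟩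
end
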